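/- Let R be a commutative ring, A an associative unital R-algebra, and V an R-submodule of A. Then the following statements are equivalent: (1) every element a of the radical r(V) that is co-integral over R and is not a unit of A is nilpotent; (2) every element a of r(V) that is co-integral over R and is a left or right zero divisor of A is nilpotent; (3) every idempotent element of A contained in V equals 0 or 1. -/

import Mathlib

/-- The radical of a set: elements all of whose sufficiently large powers lie in the set. -/
def radSet {A : Type*} [Monoid A] (S : Set A) : Set A :=
  {a | ∃ N : ℕ, ∀ m : ℕ, N ≤ m → a ^ m ∈ S}

/-- `a` is co-integral over `R`. -/
def CoIntegral (R : Type*) {A : Type*} [CommRing R] [Ring A] [Algebra R A] (a : A) : Prop :=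
  ∃ (N : ℕ) (p : Polynomial R), a ^ N = a ^ (N + 1) * Polynomial.aeval a p

/-- If all powers `a ^ m` with `M ≤ m` lie in `V`, so does `a ^ M` times any polynomial in `a`. -/
theorem pow_mul_aeval_mem {R A : Type*} [CommRing R] [Ring A] [Algebra R A]
    {V : Submodule R A} {a : A} {M : ℕ} (h : ∀ m, M ≤ m → a ^ m ∈ V) (p : Polynomial R) :
    a ^ M * Polynomial.aeval a p ∈ V := by
  rw [Polynomial.aeval_eq_sum_range, Finset.mul_sum]
  refine V.sum_mem fun i _ => ?_
  rw [mul_smul_comm, ← pow_add]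
  exact V.smul_mem _ (h _ (Nat.le_add_right M i))

theorem pow_eq_pow_add_mul_pow {M : Type*} [Monoid M] {a q : M} {N : ℕ}
    (h : a ^ N = a ^ (N + 1) * q) {m : ℕ} (hm : N ≤ m) (k : ℕ) :
    a ^ m = a ^ (m + k) * q ^ k := by
  have step (n : ℕ) (hn : N ≤ n) : a ^ n = a ^ (n + 1) * q := by
    obtain ⟨j, rfl⟩ := Nat.exists_eq_add_of_le' hn
    rw [pow_add, h, add_assoc, pow_add a j (N + 1), mul_assoc]
  induction k with
  | zero => simp
  | succ k ih =>
    calc a ^ m = a ^ (m + k) * q ^ k := ih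
      _ = a ^ (m + (k + 1)) * q * q ^ k := by rw [step (m + k) (by omega), add_assoc]
      _ = a ^ (m + (k + 1)) * q ^ (k + 1) := by rw [mul_assoc, ← pow_succ']

theorem nonunit_nilpotent_tfae {R A : Type*} [CommRing R] [Ring A] [Algebra R A]
    (V : Submodule R A) :
    List.TFAE
      [∀ a ∈ radSet (V : Set A), CoIntegral R a → ¬ IsUnit a → IsNilpotent a,
       ∀ a ∈ radSet (V : Set A), CoIntegral R a →
         (∃ x : A, x ≠ 0 ∧ (a * x = 0 ∨ x * a = 0)) → IsNilpotent a,
       ∀ e : A, e ∈ V → e ^ 2 = e → e = 0 ∨ e = 1] := by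
  tfae_have 1 → 2 := by
    rintro h a ha hco ⟨x, hx, hax⟩
    refine h a ha hco fun hu => hx ?_
    rcases hax with hax | hxa
    · exact hu.mul_right_eq_zero.mp hax
    · exact hu.mul_left_eq_zero.mp hxa
  tfae_have 2 → 3 := by
    intro h e heV he
    have hidem : IsIdempotentElem e := by rwa [IsIdempotentElem, ← sq]
    by_contra! hne
    have hpow (m : ℕ) (hm : 1 ≤ m) : e ^ m = e := hidem.pow_eq (by omega)
    obtain ⟨n, hn⟩ := h e ⟨1, fun m hm => by rw [hpow m hm]; exact heV⟩
      ⟨1, 1, by simp [he]⟩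
      ⟨1 - e, sub_ne_zero.mpr hne.2.symm, Or.inl hidem.mul_one_sub_self⟩
    exact hne.1 (by rw [← hpow (n + 1) (by omega), pow_succ, hn, zero_mul])
  tfae_have 3 → 1 := by
    rintro h a ⟨K, hK⟩ ⟨N, p, hp⟩ hu
    set q := Polynomial.aeval a p with hq
    have hc : Commute a q := by
      simpa using (Commute.all Polynomial.X p).map (Polynomial.aeval (R := R) a)
    obtain ⟨M, hNM, hKM, hM⟩ : ∃ M, N ≤ M ∧ K ≤ M ∧ M ≠ 0 :=
      ⟨N + K + 1, by omega, by omega, by omega⟩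
    have key : a ^ M = a ^ M * (a ^ M * q ^ M) := by
      rw [← mul_assoc, ← pow_add]
      exact pow_eq_pow_add_mul_pow hp hNM M
    have hcM : Commute (a ^ M) (q ^ M) := hc.pow_pow M M
    have hmem : a ^ M * q ^ M ∈ V := by
      rw [hq, ← map_pow]
      exact pow_mul_aeval_mem (fun m hm => hK m (hKM.trans hm)) _
    have hidem : (a ^ M * q ^ M) ^ 2 = a ^ M * q ^ M := by
      rw [sq, mul_assoc, ← mul_assoc (q ^ M), ← hcM.eq, mul_assoc (a ^ M) (q ^ M) (q ^ M),
        ← mul_assoc, ← mul_assoc, mul_assoc (a ^ M) (a ^ M) (q ^ M), ← key]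
    rcases h _ hmem hidem with h0 | h1
    · exact ⟨M, by rw [key, h0, mul_zero]⟩
    · refine absurd ?_ hu
      have : IsUnit (a ^ M) := ⟨⟨a ^ M, q ^ M, h1, hcM.eq ▸ h1⟩, rfl⟩
      exact (isUnit_pow_iff hM).mp this
  tfae_finish
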